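/- Let 𝕂 be an algebraically closed field of characteristic p > 0, let d ≥ 4, and suppose p > (d−1)(d−2) + 1. If F ∈ 𝕂[X,Y,Z] is a nonsingular homogeneous polynomial of degree d, then Aut(F) contains no element of order p; equivalently, the order of every finite-order element of Aut(F) is coprime to p. -/

import Mathlib

open MvPolynomial Matrix

noncomputable section

variable {K : Type*} [Field K]

/-- The substitution `F ∘ A`, i.e. `X i ↦ ∑ j, A i j • X j`. -/
def substPoly (A : Matrix (Fin 3) (Fin 3) K) (F : MvPolynomial (Fin 3) K) :
    MvPolynomial (Fin 3) K :=
  aeval (fun i => ∑ j, A i j • X j) F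

lemma substPoly_one (F : MvPolynomial (Fin 3) K) : substPoly 1 F = F := by
  have h : (fun i => ∑ j, (1 : Matrix (Fin 3) (Fin 3) K) i j • X j)
      = (X : Fin 3 → MvPolynomial (Fin 3) K) := by
    funext i
    simp [Matrix.one_apply, ite_smul]
  rw [substPoly, h]
  exact aeval_X_left_apply F

lemma substPoly_smul (A : Matrix (Fin 3) (Fin 3) K) (c : K) (F : MvPolynomial (Fin 3) K) :
    substPoly A (c • F) = c • substPoly A F := by
  unfold substPoly
  exact _root_.map_smul (aeval fun i => ∑ j, A i j • X j) c F

lemma substPoly_mul (A B : Matrix (Fin 3) (Fin 3) K) (F : MvPolynomial (Fin 3) K) :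
    substPoly (A * B) F = substPoly B (substPoly A F) := by
  have hfun : (fun i => ∑ j, (A * B) i j • (X j : MvPolynomial (Fin 3) K))
      = fun i => (aeval fun i => (∑ j, B i j • X j : MvPolynomial (Fin 3) K))
          (∑ j, A i j • X j : MvPolynomial (Fin 3) K) := by
    funext i
    rw [map_sum]
    simp only [_root_.map_smul, aeval_X, Matrix.mul_apply, Finset.sum_smul, Finset.smul_sum, smul_smul]
    exact Finset.sum_comm
  have h1 : substPoly (A * B) F
      = aeval (fun i => (aeval fun i => (∑ j, B i j • X j : MvPolynomial (Fin 3) K))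
          (∑ j, A i j • X j : MvPolynomial (Fin 3) K)) F := by
    unfold substPoly
    exact congrArg
      (fun f => (aeval f : MvPolynomial (Fin 3) K →ₐ[K] MvPolynomial (Fin 3) K) F) hfun
  rw [h1, ← MvPolynomial.comp_aeval]
  rfl

/-- The subgroup of `GL₃(K)` preserving the polynomial `F` up to scalar. -/
def autGL (F : MvPolynomial (Fin 3) K) : Subgroup (GL (Fin 3) K) where
  carrier := {A | ∃ c : Kˣ, substPoly (A : Matrix (Fin 3) (Fin 3) K) F = (c : K) • F}
  one_mem' := ⟨1, by simp [substPoly_one]⟩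
  mul_mem' := by
    rintro A B ⟨c, hc⟩ ⟨e, he⟩
    refine ⟨c * e, ?_⟩
    have hAB : ((A * B : GL (Fin 3) K) : Matrix (Fin 3) (Fin 3) K)
        = (A : Matrix (Fin 3) (Fin 3) K) * (B : Matrix (Fin 3) (Fin 3) K) := rfl
    rw [hAB, substPoly_mul, hc, substPoly_smul, he, smul_smul, ← Units.val_mul]
  inv_mem' := by
    rintro A ⟨c, hc⟩
    refine ⟨c⁻¹, ?_⟩
    have key : (c : K) • substPoly ((A⁻¹ : GL (Fin 3) K) : Matrix (Fin 3) (Fin 3) K) F = F := by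
      rw [← substPoly_smul, ← hc, ← substPoly_mul]
      have h1 : (A : Matrix (Fin 3) (Fin 3) K) *
          ((A⁻¹ : GL (Fin 3) K) : Matrix (Fin 3) (Fin 3) K) = 1 := by
        exact_mod_cast Units.mul_inv A
      rw [h1, substPoly_one]
    calc substPoly ((A⁻¹ : GL (Fin 3) K) : Matrix (Fin 3) (Fin 3) K) F
        = ((c : K)⁻¹ * (c : K)) •
            substPoly ((A⁻¹ : GL (Fin 3) K) : Matrix (Fin 3) (Fin 3) K) F := by
          rw [inv_mul_cancel₀ (Units.ne_zero c), one_smul]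
      _ = (c : K)⁻¹ • ((c : K) •
            substPoly ((A⁻¹ : GL (Fin 3) K) : Matrix (Fin 3) (Fin 3) K) F) := by
          rw [smul_smul]
      _ = (c : K)⁻¹ • F := by rw [key]
      _ = ((c⁻¹ : Kˣ) : K) • F := by rw [Units.val_inv_eq_inv_val]

/-- `PGL₃(K)`: the quotient of `GL₃(K)` by its center (the scalar matrices). -/
abbrev PGL3 (K : Type*) [Field K] := GL (Fin 3) K ⧸ Subgroup.center (GL (Fin 3) K)

/-- The automorphism group of the plane curve `F = 0`, as a subgroup of `PGL₃(K)`: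
the classes of matrices `A` with `F ∘ A = λ • F` for some `λ ∈ Kˣ`. -/
def projAut (F : MvPolynomial (Fin 3) K) : Subgroup (PGL3 K) :=
  (autGL F).map (QuotientGroup.mk' (Subgroup.center (GL (Fin 3) K)))

/-- `F` is nonsingular: the only common zero of its partial derivatives is the origin. -/
def IsNonsingular (F : MvPolynomial (Fin 3) K) : Prop :=
  ∀ x : Fin 3 → K, (∀ i, eval x (pderiv i F) = 0) → x = 0

/-- `F` and `G` are projectively equivalent: `F ∘ A = λ • G` for some `A ∈ GL₃(K)`, `λ ∈ Kˣ`. -/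
def ProjEquiv (F G : MvPolynomial (Fin 3) K) : Prop :=
  ∃ A : GL (Fin 3) K, ∃ c : Kˣ,
    substPoly (A : Matrix (Fin 3) (Fin 3) K) F = (c : K) • G


lemma hom_exp_sum {G : MvPolynomial (Fin 3) K} {m : ℕ} (hG : G.IsHomogeneous m)
    {s : Fin 3 →₀ ℕ} (hs : s ∈ G.support) : s 0 + s 1 + s 2 = m := by
  have h := hG (MvPolynomial.mem_support_iff.1 hs)
  rw [Finsupp.weight_apply, Finsupp.sum_fintype _ _ (by simp)] at h
  simpa [Fin.sum_univ_three] using h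

/-- Top coefficient of the restriction of a form to a polynomial curve. -/
lemma aeval_curve {G : MvPolynomial (Fin 3) K} {m : ℕ} (hG : G.IsHomogeneous m)
    (f : Fin 3 → Polynomial K) (e : ℕ) (hf : ∀ i, (f i).natDegree ≤ e) :
    (aeval f G).natDegree ≤ m * e ∧
      (aeval f G).coeff (m * e) = eval (fun i => (f i).coeff e) G := by
  have hdeg : ∀ i (n : ℕ), (f i ^ n).natDegree ≤ n * e := fun i n =>
    Polynomial.natDegree_pow_le.trans (Nat.mul_le_mul_left _ (hf i))
  rw [aeval_def, eval₂_eq', eval_eq']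
  constructor
  · refine Polynomial.natDegree_sum_le_of_forall_le _ _ fun s hs => ?_
    rw [← hom_exp_sum hG hs, Fin.prod_univ_three, add_mul, add_mul]
    refine (Polynomial.natDegree_C_mul_le _ _).trans ?_
    exact Polynomial.natDegree_mul_le_of_le
      (Polynomial.natDegree_mul_le_of_le (hdeg _ _) (hdeg _ _)) (hdeg _ _)
  · rw [Polynomial.finsetSum_coeff]
    refine Finset.sum_congr rfl fun s hs => ?_
    rw [← hom_exp_sum hG hs, Fin.prod_univ_three, add_mul, add_mul, Fin.prod_univ_three]
    change (Polynomial.C _ * _).coeff _ = _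
    rw [Polynomial.coeff_C_mul,
      Polynomial.coeff_mul_add_eq_of_natDegree_le
        (Polynomial.natDegree_mul_le_of_le (hdeg _ _) (hdeg _ _)) (hdeg _ _),
      Polynomial.coeff_mul_add_eq_of_natDegree_le (hdeg _ _) (hdeg _ _),
      Polynomial.coeff_pow_of_natDegree_le (hf _), Polynomial.coeff_pow_of_natDegree_le (hf _),
      Polynomial.coeff_pow_of_natDegree_le (hf _)]

lemma substPoly_smul_left {G : MvPolynomial (Fin 3) K} {m : ℕ} (hG : G.IsHomogeneous m)
    (A : Matrix (Fin 3) (Fin 3) K) (c : K) :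
    substPoly (c • A) G = c ^ m • substPoly A G := by
  have hrow : (fun i => ∑ j, (c • A) i j • (X j : MvPolynomial (Fin 3) K))
      = fun i => c • ∑ j, A i j • (X j : MvPolynomial (Fin 3) K) := by
    funext i
    rw [Finset.smul_sum]
    refine Finset.sum_congr rfl fun j _ => ?_
    rw [smul_smul]
    rfl
  unfold substPoly
  rw [hrow, aeval_def, aeval_def, eval₂_eq', eval₂_eq', Finset.smul_sum]
  refine Finset.sum_congr rfl fun s hs => ?_
  rw [← hom_exp_sum hG hs, Fin.prod_univ_three, Fin.prod_univ_three]
  simp only [smul_pow, Algebra.smul_mul_assoc, Algebra.mul_smul_comm, smul_smul]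
  congr 1
  ring

lemma pderiv_substPoly (A : Matrix (Fin 3) (Fin 3) K) (F : MvPolynomial (Fin 3) K) (j : Fin 3) :
    pderiv j (substPoly A F) = ∑ i, A i j • substPoly A (pderiv i F) := by
  unfold substPoly
  induction F using MvPolynomial.induction_on with
  | C a => simp
  | add f g hf hg => simp only [map_add, hf, hg, smul_add, Finset.sum_add_distrib]
  | mul_X f k hf =>
    simp only [map_mul, Derivation.leibniz, hf, aeval_X, map_add, smul_add,
      Finset.sum_add_distrib, smul_eq_mul]
    have h1 : pderiv j (∑ l, A k l • (X l : MvPolynomial (Fin 3) K)) = C (A k j) := by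
      simp [pderiv_X, Pi.single_apply, smul_eq_C_mul, eq_comm]
    rw [h1]
    congr 1
    · simp [pderiv_X, Pi.single_apply, smul_eq_C_mul, mul_comm, apply_ite, Finset.sum_ite_eq]
    · rw [Finset.mul_sum]
      simp only [mul_smul_comm]

lemma eval_substPoly (A : Matrix (Fin 3) (Fin 3) K) (F : MvPolynomial (Fin 3) K)
    (x : Fin 3 → K) : eval x (substPoly A F) = eval (A *ᵥ x) F := by
  unfold substPoly
  induction F using MvPolynomial.induction_on with
  | C a => simp
  | add f g hf hg => simp only [map_add, hf, hg]
  | mul_X f k hf =>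
    simp only [map_mul, hf, aeval_X, eval_X]
    simp [Matrix.mulVec, dotProduct]

/-- The gradient of an invariant form. -/
lemma grad_invariant {A B : Matrix (Fin 3) (Fin 3) K} {F : MvPolynomial (Fin 3) K}
    (hA : substPoly A F = F) (hAB : A * B = 1) (x : Fin 3 → K) (k : Fin 3) :
    eval (A *ᵥ x) (pderiv k F) = ∑ j, eval x (pderiv j F) * B j k := by
  have h : (fun j => eval x (pderiv j F)) = (fun i => eval (A *ᵥ x) (pderiv i F)) ᵥ* A := by
    funext j
    conv_lhs => rw [← hA]
    rw [pderiv_substPoly, map_sum]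
    simp [Matrix.vecMul, dotProduct, eval_substPoly, smul_eval, mul_comm]
  have h2 : (fun j => eval x (pderiv j F)) ᵥ* B = (fun i => eval (A *ᵥ x) (pderiv i F)) := by
    rw [h, Matrix.vecMul_vecMul, hAB, Matrix.vecMul_one]
  have h3 := congrFun h2 k
  rw [← h3]
  rfl

/-- If a form and its invariance hold along a curve of degree `e`, the gradient vanishes at the
leading point. -/
lemma grad_leading {p : ℕ} [CharP K p] {G : MvPolynomial (Fin 3) K} {m : ℕ}
    (hG : G.IsHomogeneous m) (f : Fin 3 → Polynomial K) (e : ℕ)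
    (hf : ∀ i, (f i).natDegree ≤ e) (Q : Polynomial K) (hQ : Q.natDegree ≤ e)
    (he : 0 < e) (hm : 1 < m) (hp : m * e < p)
    (h : ∀ n : ℕ, eval (fun i => (f i).eval (n : K)) G = Q.eval (n : K)) :
    eval (fun i => (f i).coeff e) G = 0 := by
  obtain ⟨h1, h2⟩ := aeval_curve hG f e hf
  have hlt : e < m * e := by nlinarith
  have heq : aeval f G = Q := by
    refine Polynomial.eq_of_degree_sub_lt_of_eval_index_eq (Finset.range p)
      (v := fun n : ℕ => (n : K)) ?_ ?_ ?_
    · intro a ha b hb hab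
      simp only [Finset.coe_range, Set.mem_Iio] at ha hb
      exact CharP.natCast_injOn_Iio K p ha hb hab
    · rw [Finset.card_range]
      refine lt_of_le_of_lt (Polynomial.degree_le_natDegree) ?_
      have := Polynomial.natDegree_sub_le_of_le h1 (hQ.trans hlt.le)
      rw [max_self] at this
      exact_mod_cast this.trans_lt hp
    · intro n _
      rw [← h n]
      change Polynomial.evalRingHom (n : K) (aeval f G) = _
      rw [aeval_def, MvPolynomial.hom_eval₂]
      have : (Polynomial.evalRingHom (n : K)).comp (algebraMap K (Polynomial K))
          = RingHom.id K := by ext; simp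
      rw [this]
      rfl
  rw [← h2, heq]
  exact Polynomial.coeff_eq_zero_of_natDegree_lt (hQ.trans_lt hlt)

lemma no_unipotent {p : ℕ} [Fact p.Prime] [CharP K p] {d : ℕ} (hd : 4 ≤ d) (hpd : 2 * d < p)
    {F : MvPolynomial (Fin 3) K} (hhom : F.IsHomogeneous d) (hns : IsNonsingular F)
    {N : Matrix (Fin 3) (Fin 3) K} (hN3 : N ^ 3 = 0) (hN : N ≠ 0)
    (hF : substPoly (1 + N) F = F) : False := by
  have h2 : (2 : K) ≠ 0 := by
    have := (CharP.cast_eq_zero_iff K p 2).not.2 (Nat.not_dvd_of_pos_of_lt (by norm_num) (by omega))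
    exact_mod_cast this
  have hpow : ∀ n : ℕ, substPoly ((1 + N) ^ n) F = F := by
    intro n
    induction n with
    | zero => simp [substPoly_one]
    | succ n ih => rw [pow_succ, substPoly_mul, ih, hF]
  have hN21 : N ^ 2 * N = 0 := by rw [← pow_succ, hN3]
  have hN12 : N * N ^ 2 = 0 := by rw [← pow_succ', hN3]
  have hN22 : N ^ 2 * N ^ 2 = 0 := by rw [← pow_add, pow_succ, hN3, zero_mul]
  have hU : ∀ n : ℕ, (1 + N) ^ n
      = 1 + (n : K) • N + ((n : K) * (n - 1) / 2) • N ^ 2 := by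
    intro n
    induction n with
    | zero => simp
    | succ n ih =>
      rw [pow_succ, ih]
      simp only [add_mul, mul_add, one_mul, mul_one, smul_mul_assoc, hN21, smul_zero, ← pow_two]
      push_cast
      match_scalars <;> field_simp <;> ring
  have hUV : ∀ n : ℕ, (1 + N) ^ n * (1 - (n : K) • N + ((n : K) * (n + 1) / 2) • N ^ 2) = 1 := by
    intro n
    rw [hU]
    simp only [add_mul, mul_add, mul_sub, one_mul, mul_one, smul_mul_assoc, mul_smul_comm, hN21,
      hN12, hN22, smul_zero, ← pow_two]
    match_scalars <;> field_simp <;> ring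
  have hgrad := fun (x : Fin 3 → K) (n : ℕ) k => grad_invariant (hpow n) (hUV n) x k
  have hGh : ∀ k, (pderiv k F).IsHomogeneous (d - 1) := fun k => hhom.pderiv
  by_cases hsq : N ^ 2 = 0
  · have hv : ∀ x, N *ᵥ x = 0 := by
      intro x
      apply hns
      intro k
      have := grad_leading (p := p) (hGh k)
        (fun i => Polynomial.C (x i) + Polynomial.C ((N *ᵥ x) i) * Polynomial.X) 1
        (fun i => by compute_degree)
        (∑ j, Polynomial.C (eval x (pderiv j F)) *
          (Polynomial.C ((1 : Matrix (Fin 3) (Fin 3) K) j k)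
            - Polynomial.C (N j k) * Polynomial.X))
        (Polynomial.natDegree_sum_le_of_forall_le _ _ fun j _ => by compute_degree)
        one_pos (by omega) (by omega) (by
          intro n
          have h := hgrad x n k
          rw [hU, hsq, smul_zero, smul_zero, add_zero, add_zero] at h
          simp only [Polynomial.eval_finsetSum, Polynomial.eval_mul, Polynomial.eval_sub,
            Polynomial.eval_C, Polynomial.eval_X, Polynomial.eval_add]
          convert h using 2
          · congr 1
            funext i
            simp [Matrix.add_mulVec, Matrix.smul_mulVec, mul_comm]
          · simp [mul_comm])
      simpa [Polynomial.coeff_C] using this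
    apply hN
    ext i j
    have := congrFun (hv (Pi.single j 1)) i
    simpa using this
  · have hv : ∀ x, (2⁻¹ : K) • (N ^ 2 *ᵥ x) = 0 := by
      intro x
      apply hns
      intro k
      have := grad_leading (p := p) (hGh k)
        (fun i => Polynomial.C (x i) + Polynomial.C ((N *ᵥ x) i) * Polynomial.X
          + Polynomial.C (2⁻¹ * (N ^ 2 *ᵥ x) i) * (Polynomial.X ^ 2 - Polynomial.X)) 2
        (fun i => by compute_degree)
        (∑ j, Polynomial.C (eval x (pderiv j F)) *
          (Polynomial.C ((1 : Matrix (Fin 3) (Fin 3) K) j k)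
            - Polynomial.C (N j k) * Polynomial.X
            + Polynomial.C (2⁻¹ * (N ^ 2) j k) * (Polynomial.X ^ 2 + Polynomial.X)))
        (Polynomial.natDegree_sum_le_of_forall_le _ _ fun j _ => by compute_degree)
        two_pos (by omega) (by omega) (by
          intro n
          have h := hgrad x n k
          rw [hU] at h
          simp only [Polynomial.eval_finsetSum, Polynomial.eval_mul, Polynomial.eval_sub,
            Polynomial.eval_C, Polynomial.eval_X, Polynomial.eval_add, Polynomial.eval_pow]
          convert h using 2
          · congr 1
            funext i
            simp only [Matrix.add_mulVec, Matrix.smul_mulVec, Pi.add_apply, Pi.smul_apply,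
              Matrix.one_mulVec, smul_eq_mul]
            ring
          · simp only [Matrix.add_apply, Matrix.sub_apply, Matrix.smul_apply, smul_eq_mul]
            ring)
      convert this using 2
      congr 1
      funext i
      simp [Polynomial.coeff_X, mul_assoc, -map_mul, Polynomial.coeff_C_mul, Polynomial.coeff_C]
    apply hsq
    ext i j
    have := congrFun (hv (Pi.single j 1)) i
    simpa [h2] using this

lemma nilp_cube {N : Matrix (Fin 3) (Fin 3) K} (h : IsNilpotent N) : N ^ 3 = 0 := by
  have h1 := (Matrix.isNilpotent_charpoly_sub_pow_of_isNilpotent h).eq_zero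
  rw [sub_eq_zero] at h1
  have h2 := Matrix.aeval_self_charpoly N
  rw [h1] at h2
  simpa using h2

lemma no_order_p [IsAlgClosed K] {p : ℕ} [Fact p.Prime] [CharP K p] {d : ℕ} (hd : 4 ≤ d)
    (hpd : 2 * d < p)
    {F : MvPolynomial (Fin 3) K} (hhom : F.IsHomogeneous d) (hns : IsNonsingular F)
    (g : PGL3 K) (hg : g ∈ projAut F) : orderOf g ≠ p := by
  intro ho
  have hp : p.Prime := Fact.out
  obtain ⟨A, ⟨c, hc⟩, rfl⟩ := hg
  have hpow : (A ^ p) ∈ Subgroup.center (GL (Fin 3) K) := by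
    have h := pow_orderOf_eq_one (QuotientGroup.mk' (Subgroup.center (GL (Fin 3) K)) A)
    rw [ho, ← map_pow] at h
    exact (QuotientGroup.eq_one_iff _).1 h
  have hne : A ∉ Subgroup.center (GL (Fin 3) K) := by
    intro h
    have h' : QuotientGroup.mk' (Subgroup.center (GL (Fin 3) K)) A = 1 :=
      (QuotientGroup.eq_one_iff _).2 h
    rw [h', orderOf_one] at ho
    exact hp.one_lt.ne ho
  rw [Matrix.GeneralLinearGroup.mem_center_iff_val_mem_range_scalar] at hpow hne
  obtain ⟨a, ha⟩ := hpow
  obtain ⟨μ, hμ⟩ := IsAlgClosed.exists_pow_nat_eq a hp.pos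
  have haA : (A : Matrix (Fin 3) (Fin 3) K) ^ p = a • (1 : Matrix (Fin 3) (Fin 3) K) := by
    rw [← Units.val_pow_eq_pow_val, ← ha]
    simp [Matrix.smul_one_eq_diagonal]
  have ha0 : a ≠ 0 := by
    rintro rfl
    rw [zero_smul, ← Units.val_pow_eq_pow_val] at haA
    exact Units.ne_zero _ haA
  have hμ0 : μ ≠ 0 := by
    rintro rfl
    exact ha0 (by rw [← hμ, zero_pow hp.ne_zero])
  obtain ⟨U, hUdef⟩ : ∃ U, U = μ⁻¹ • (A : Matrix (Fin 3) (Fin 3) K) := ⟨_, rfl⟩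
  have hUp : U ^ p = 1 := by
    rw [hUdef, smul_pow, haA, smul_smul, inv_pow, hμ, inv_mul_cancel₀ ha0, one_smul]
  have hnil : (U - 1) ^ p = 0 := by
    rw [sub_pow_char_of_commute _ (Commute.one_right U), hUp, one_pow, sub_self]
  have hU1 : U - 1 ≠ 0 := by
    intro h
    apply hne
    refine ⟨μ, ?_⟩
    rw [sub_eq_zero] at h
    have : (A : Matrix (Fin 3) (Fin 3) K) = μ • U := by
      rw [hUdef, smul_smul, mul_inv_cancel₀ hμ0, one_smul]
    rw [this, h]
    simp [Matrix.smul_one_eq_diagonal]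
  obtain ⟨l, hl⟩ : ∃ l : K, substPoly U F = l • F :=
    ⟨_, by rw [hUdef, substPoly_smul_left hhom, hc, smul_smul]⟩
  have hln : ∀ n : ℕ, substPoly (U ^ n) F = l ^ n • F := by
    intro n
    induction n with
    | zero => simp [substPoly_one]
    | succ n ih => rw [pow_succ, substPoly_mul, ih, substPoly_smul, hl, smul_smul, pow_succ]
  have hF0 : F ≠ 0 := by
    rintro rfl
    have := hns (fun _ => 1) (by simp)
    exact one_ne_zero (congrFun this 0)
  have hl1 : l = 1 := by
    have h := hln p
    rw [hUp, substPoly_one] at h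
    have h' : (l ^ p - 1) • F = 0 := by rw [sub_smul, ← h, one_smul, sub_self]
    rcases smul_eq_zero.1 h' with h'' | h''
    · have h3 : (l - 1) ^ p = 0 := by rw [sub_pow_char, one_pow, h'']
      exact sub_eq_zero.1 (pow_eq_zero_iff hp.ne_zero |>.1 h3)
    · exact absurd h'' hF0
  refine no_unipotent (p := p) hd hpd hhom hns (nilp_cube ⟨p, hnil⟩) hU1 ?_
  rw [add_sub_cancel, hl, hl1, one_smul]

/-- over an algebraically closed field of characteristic
`p > (d-1)(d-2)+1`, the automorphism group of a nonsingular plane curve of degree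
`d ≥ 4` contains no element of order `p`; equivalently the order of every
finite-order element is coprime to `p`. -/
theorem stmt19 {K : Type*} [Field K] [IsAlgClosed K]
    (p : ℕ) [CharP K p] (hp : 0 < p)
    (d : ℕ) (hd : 4 ≤ d) (hpd : (d - 1) * (d - 2) + 1 < p)
    (F : MvPolynomial (Fin 3) K)
    (hhom : F.IsHomogeneous d) (hns : IsNonsingular F) :
    (∀ g ∈ projAut F, orderOf g ≠ p) ∧
    (∀ g ∈ projAut F, orderOf g ≠ 0 → Nat.Coprime (orderOf g) p) := by
  have hprime : p.Prime := (CharP.char_is_prime_or_zero K p).resolve_right hp.ne'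
  haveI : Fact p.Prime := ⟨hprime⟩
  have h2d : 2 * d < p := by
    rcases Nat.lt_or_ge 4 d with h | h
    · obtain ⟨e, rfl⟩ := Nat.exists_eq_add_of_le h
      have h1 : 4 + 1 + e - 1 = e + 4 := by omega
      have h2 : 4 + 1 + e - 2 = e + 3 := by omega
      rw [h1, h2] at hpd
      nlinarith
    · have h4 : d = 4 := by omega
      subst h4
      norm_num at hpd
      by_contra hlt
      have h8 : p = 8 := by omega
      rw [h8] at hprime
      norm_num at hprime
  have main := fun g hg => no_order_p (p := p) hd h2d hhom hns g hg
  refine ⟨main, fun g hg h0 => ?_⟩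
  rw [Nat.coprime_comm, hprime.coprime_iff_not_dvd]
  intro hdvd
  exact main (g ^ (orderOf g / p)) (Subgroup.pow_mem _ hg _) (orderOf_pow_orderOf_div h0 hdvd)

end
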